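/- Let k ≥ 1 and let A_i, B_{i1}, …, B_{ik} ∈ ℂ^{m_i×n_i} for 1 ≤ i ≤ k. Consider the function F(γ, α_1, …, α_k, x_1, …, x_k) = Σ_{i=1}^k ‖γ A_i x_i − Σ_{s=1}^k α_s B_{is} x_i‖₂² on the set of tuples with γ ∈ ℝ, γ ≥ 0, α_1, …, α_k ∈ ℂ, γ² + Σ_{s=1}^k |α_s|² = 1, and ‖x_i‖₂ = 1 for every i. Then F attains its minimum on this set, and the minimum value equals θ₁. -/

import Mathlib

open scoped BigOperators
open Matrix

noncomputable section

/-- Squared Frobenius norm of a complex matrix. -/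
def frobSq {α β : Type} [Fintype α] [Fintype β] (M : Matrix α β ℂ) : ℝ :=
  ∑ i, ∑ j, ‖M i j‖ ^ 2

/-- Squared Euclidean norm of a complex vector. -/
def vecNormSq {α : Type} [Fintype α] (x : α → ℂ) : ℝ :=
  ∑ i, ‖x i‖ ^ 2

/-- Horizontal concatenation `[A, B 0, B 1, …, B (k-1)]`. -/
def hcat {m n k : ℕ} (A : Matrix (Fin m) (Fin n) ℂ)
    (B : Fin k → Matrix (Fin m) (Fin n) ℂ) :
    Matrix (Fin m) (Fin (k + 1) × Fin n) ℂ :=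
  Matrix.of fun i p => Fin.cases (A i p.2) (fun s => B s i p.2) p.1

/-- The homogeneous objective function
`F(γ, α, x) = ∑ i ‖γ A i x i − ∑ s α s • B i s x i‖²`. -/
def Fobj {k : ℕ} {m n : Fin k → ℕ}
    (A : ∀ i, Matrix (Fin (m i)) (Fin (n i)) ℂ)
    (B : ∀ i, Fin k → Matrix (Fin (m i)) (Fin (n i)) ℂ)
    (γ : ℝ) (α : Fin k → ℂ) (x : ∀ i, Fin (n i) → ℂ) : ℝ :=
  ∑ i, vecNormSq ((γ : ℂ) • (A i).mulVec (x i) - ∑ s, α s • (B i s).mulVec (x i))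

/-- The Kronecker product of `(γ, -α)` with `x`. -/
def coeffTensor {k n : ℕ} (γ : ℂ) (α : Fin k → ℂ) (x : Fin n → ℂ) :
    Fin (k + 1) × Fin n → ℂ :=
  fun p => (Fin.cons γ (-α) : Fin (k + 1) → ℂ) p.1 * x p.2

lemma vecNormSq_nonneg {α : Type} [Fintype α] (x : α → ℂ) : 0 ≤ vecNormSq x :=
  Finset.sum_nonneg fun _ _ => by positivity

lemma frobSq_nonneg {α β : Type} [Fintype α] [Fintype β] (M : Matrix α β ℂ) : 0 ≤ frobSq M :=
  Finset.sum_nonneg fun _ _ => Finset.sum_nonneg fun _ _ => by positivity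

lemma vecNormSq_smul {α : Type} [Fintype α] (c : ℂ) (x : α → ℂ) :
    vecNormSq (c • x) = ‖c‖ ^ 2 * vecNormSq x := by
  simp [vecNormSq, Finset.mul_sum, mul_pow]

lemma vecNormSq_neg {α : Type} [Fintype α] (x : α → ℂ) : vecNormSq (-x) = vecNormSq x := by
  simp [vecNormSq]

lemma vecNormSq_mulVec_le {α β : Type} [Fintype α] [Fintype β] (M : Matrix α β ℂ) (w : β → ℂ) :
    vecNormSq (M *ᵥ w) ≤ frobSq M * vecNormSq w := by
  unfold vecNormSq frobSq
  rw [Finset.sum_mul]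
  refine Finset.sum_le_sum fun i _ => ?_
  have h : ‖(M *ᵥ w) i‖ ≤ ∑ j, ‖M i j‖ * ‖w j‖ :=
    (norm_sum_le _ _).trans_eq (Finset.sum_congr rfl fun j _ => norm_mul _ _)
  exact (pow_le_pow_left₀ (norm_nonneg _) h 2).trans (Finset.sum_mul_sq_le_sq_mul_sq _ _ _)

lemma frobSq_vecMulVec {α β : Type} [Fintype α] [Fintype β] (u : α → ℂ) (w : β → ℂ) :
    frobSq (vecMulVec u w) = vecNormSq u * vecNormSq w := by
  simp [vecNormSq, frobSq, vecMulVec_apply, mul_pow, Finset.sum_mul_sum]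

lemma star_dotProduct_self {α : Type} [Fintype α] (w : α → ℂ) :
    star w ⬝ᵥ w = (vecNormSq w : ℂ) := by
  simp [dotProduct, vecNormSq, Complex.conj_mul']

lemma vecNormSq_star {α : Type} [Fintype α] (w : α → ℂ) : vecNormSq (star w) = vecNormSq w := by
  simp [vecNormSq]

lemma vecNormSq_coeffTensor {k n : ℕ} (γ : ℂ) (α : Fin k → ℂ) (x : Fin n → ℂ) :
    vecNormSq (coeffTensor γ α x) = (‖γ‖ ^ 2 + ∑ s, ‖α s‖ ^ 2) * vecNormSq x := by
  simp only [vecNormSq, coeffTensor, Fintype.sum_prod_type, norm_mul, mul_pow, ← Finset.mul_sum,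
    ← Finset.sum_mul, Fin.sum_univ_succ]
  simp

lemma hcat_mulVec_coeffTensor {m n k : ℕ} (A : Matrix (Fin m) (Fin n) ℂ)
    (B : Fin k → Matrix (Fin m) (Fin n) ℂ) (γ : ℂ) (α : Fin k → ℂ) (x : Fin n → ℂ) :
    hcat A B *ᵥ coeffTensor γ α x = γ • A *ᵥ x - ∑ s, α s • B s *ᵥ x := by
  ext i
  simp [hcat, coeffTensor, mulVec, dotProduct, Fintype.sum_prod_type, Fin.sum_univ_succ,
    Finset.mul_sum, sub_eq_add_neg, mul_left_comm]

lemma hcat_add {m n k : ℕ} (A A' : Matrix (Fin m) (Fin n) ℂ)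
    (B B' : Fin k → Matrix (Fin m) (Fin n) ℂ) :
    hcat (A + A') (fun s => B s + B' s) = hcat A B + hcat A' B' := by
  ext i ⟨p, j⟩
  refine Fin.cases ?_ (fun s => ?_) p <;> simp [hcat]

lemma hcat_blocks {m n k : ℕ} (E : Matrix (Fin m) (Fin (k + 1) × Fin n) ℂ) :
    hcat (of fun i j => E i (0, j)) (fun s => of fun i j => E i (s.succ, j)) = E := by
  ext i ⟨p, j⟩
  refine Fin.cases ?_ (fun s => ?_) p <;> simp [hcat]

/-- A perturbation annihilating `coeffTensor γ α x` costs at least the squared residual. -/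
lemma vecNormSq_residual_le {m n k : ℕ} (A Ah : Matrix (Fin m) (Fin n) ℂ)
    (B Bh : Fin k → Matrix (Fin m) (Fin n) ℂ) (γ : ℂ) (α : Fin k → ℂ) (x : Fin n → ℂ)
    (hα : ‖γ‖ ^ 2 + ∑ s, ‖α s‖ ^ 2 = 1) (hx : vecNormSq x = 1)
    (h : γ • Ah *ᵥ x - ∑ s, α s • Bh s *ᵥ x = 0) :
    vecNormSq (γ • A *ᵥ x - ∑ s, α s • B s *ᵥ x) ≤
      frobSq (hcat (Ah - A) (fun s => Bh s - B s)) := by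
  have key : γ • A *ᵥ x - ∑ s, α s • B s *ᵥ x =
      -(hcat (Ah - A) (fun s => Bh s - B s) *ᵥ coeffTensor γ α x) := by
    have hadd := hcat_add A (Ah - A) B (fun s => Bh s - B s)
    simp only [add_sub_cancel] at hadd
    rw [← hcat_mulVec_coeffTensor, hadd, add_mulVec] at h
    rw [← hcat_mulVec_coeffTensor]
    exact eq_neg_of_add_eq_zero_left h
  rw [key, vecNormSq_neg]
  simpa [vecNormSq_coeffTensor, hα, hx] using
    vecNormSq_mulVec_le (hcat (Ah - A) (fun s => Bh s - B s)) (coeffTensor γ α x)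

/-- A rank-one perturbation annihilating `coeffTensor γ α x` costs exactly the squared residual. -/
lemma exists_perturbation {m n k : ℕ} (A : Matrix (Fin m) (Fin n) ℂ)
    (B : Fin k → Matrix (Fin m) (Fin n) ℂ) (γ : ℂ) (α : Fin k → ℂ) (x : Fin n → ℂ)
    (hα : ‖γ‖ ^ 2 + ∑ s, ‖α s‖ ^ 2 = 1) (hx : vecNormSq x = 1) :
    ∃ (Ah : Matrix (Fin m) (Fin n) ℂ) (Bh : Fin k → Matrix (Fin m) (Fin n) ℂ),
      γ • Ah *ᵥ x - ∑ s, α s • Bh s *ᵥ x = 0 ∧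
      frobSq (hcat (Ah - A) (fun s => Bh s - B s)) =
        vecNormSq (γ • A *ᵥ x - ∑ s, α s • B s *ᵥ x) := by
  set w := coeffTensor γ α x with hw
  set r := γ • A *ᵥ x - ∑ s, α s • B s *ᵥ x with hr
  have hw1 : vecNormSq w = 1 := by rw [hw, vecNormSq_coeffTensor, hα, hx, one_mul]
  let E := vecMulVec (-r) (star w)
  refine ⟨A + of fun i j => E i (0, j), fun s => B s + of fun i j => E i (s.succ, j), ?_, ?_⟩
  · rw [← hcat_mulVec_coeffTensor, hcat_add, add_mulVec, hcat_blocks, hcat_mulVec_coeffTensor,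
      ← hr, ← hw, vecMulVec_mulVec, star_dotProduct_self, hw1]
    simp
  · simp only [add_sub_cancel_left]
    rw [hcat_blocks, frobSq_vecMulVec, vecNormSq_neg, vecNormSq_star, hw1, mul_one]

lemma continuous_Fobj {k : ℕ} {m n : Fin k → ℕ}
    (A : ∀ i, Matrix (Fin (m i)) (Fin (n i)) ℂ)
    (B : ∀ i, Fin k → Matrix (Fin (m i)) (Fin (n i)) ℂ) :
    Continuous fun q : ℝ × (Fin k → ℂ) × (∀ i, Fin (n i) → ℂ) =>
      Fobj A B q.1 q.2.1 q.2.2 := by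
  simp only [Fobj, vecNormSq, mulVec, dotProduct, Pi.sub_apply, Pi.smul_apply, Finset.sum_apply]
  fun_prop

lemma norm_apply_le_one_of_vecNormSq_eq_one {α : Type} [Fintype α] {x : α → ℂ}
    (hx : vecNormSq x = 1) (j : α) : ‖x j‖ ≤ 1 := by
  have h := Finset.single_le_sum (f := fun j => ‖x j‖ ^ 2) (fun _ _ => by positivity)
    (Finset.mem_univ j)
  have h' : ‖x j‖ ^ 2 ≤ 1 := h.trans_eq hx
  exact (sq_le_one_iff₀ (norm_nonneg _)).1 h'

/-- The constraint set of `Fobj`. -/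
def constraintSet {k : ℕ} (n : Fin k → ℕ) :
    Set (ℝ × (Fin k → ℂ) × (∀ i, Fin (n i) → ℂ)) :=
  {q | 0 ≤ q.1 ∧ q.1 ^ 2 + ∑ s, ‖q.2.1 s‖ ^ 2 = 1 ∧ ∀ i, vecNormSq (q.2.2 i) = 1}

lemma isCompact_constraintSet {k : ℕ} (n : Fin k → ℕ) : IsCompact (constraintSet n) := by
  refine Metric.isCompact_of_isClosed_isBounded ?_ ?_
  · simp only [constraintSet, vecNormSq, Set.ofPred_and, Set.ofPred_forall]
    refine (isClosed_le (by fun_prop) (by fun_prop)).inter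
      ((isClosed_eq (by fun_prop) (by fun_prop)).inter
        (isClosed_iInter fun i => isClosed_eq (by fun_prop) (by fun_prop)))
  · refine (Metric.isBounded_closedBall (x := 0) (r := 1)).subset ?_
    rintro ⟨γ, α, x⟩ ⟨h0, h1, h2⟩
    dsimp only at h0 h1 h2
    have hsum : 0 ≤ ∑ s, ‖α s‖ ^ 2 := vecNormSq_nonneg α
    rw [mem_closedBall_zero_iff, norm_prod_le_iff, norm_prod_le_iff]
    refine ⟨?_, ?_, ?_⟩
    · rw [Real.norm_of_nonneg h0]
      exact (sq_le_one_iff₀ h0).1 (by linarith)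
    · refine (pi_norm_le_iff_of_nonneg zero_le_one).2 fun s => ?_
      have h := Finset.single_le_sum (f := fun s => ‖α s‖ ^ 2) (fun _ _ => by positivity)
        (Finset.mem_univ s)
      exact (sq_le_one_iff₀ (norm_nonneg _)).1 (by nlinarith)
    · exact (pi_norm_le_iff_of_nonneg zero_le_one).2 fun i =>
        (pi_norm_le_iff_of_nonneg zero_le_one).2 fun j =>
          norm_apply_le_one_of_vecNormSq_eq_one (h2 i) j

lemma constraintSet_nonempty {k : ℕ} (n : Fin k → ℕ) (hn : ∀ i, 0 < n i) :
    (constraintSet n).Nonempty := by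
  refine ⟨(1, 0, fun i => Pi.single ⟨0, hn i⟩ 1), by simp, by simp, fun i => ?_⟩
  simp [vecNormSq, Pi.single_apply, apply_ite]

/-- The squared sizes of the perturbations making the system solvable. -/
def perturbationCosts {k : ℕ} {m n : Fin k → ℕ}
    (A : ∀ i, Matrix (Fin (m i)) (Fin (n i)) ℂ)
    (B : ∀ i, Fin k → Matrix (Fin (m i)) (Fin (n i)) ℂ) : Set ℝ :=
  {t : ℝ |
    ∃ (Ah : ∀ i, Matrix (Fin (m i)) (Fin (n i)) ℂ)
      (Bh : ∀ i, Fin k → Matrix (Fin (m i)) (Fin (n i)) ℂ)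
      (lam : Fin k → ℂ) (xx : ∀ i, Fin (n i) → ℂ),
      (∀ i, vecNormSq (xx i) = 1) ∧
      (∀ i, (Ah i).mulVec (xx i) = ∑ s, lam s • (Bh i s).mulVec (xx i)) ∧
      t = ∑ i, frobSq (hcat (Ah i - A i) (fun s => Bh i s - B i s))}

section

variable {k : ℕ} {m n : Fin k → ℕ} (A : ∀ i, Matrix (Fin (m i)) (Fin (n i)) ℂ)
  (B : ∀ i, Fin k → Matrix (Fin (m i)) (Fin (n i)) ℂ)

lemma bddBelow_perturbationCosts : BddBelow (perturbationCosts A B) := by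
  refine ⟨0, ?_⟩
  rintro t ⟨_, _, _, _, _, _, rfl⟩
  exact Finset.sum_nonneg fun _ _ => frobSq_nonneg _

lemma Fobj_mem_perturbationCosts {g : ℝ} {a : Fin k → ℂ} {x : ∀ i, Fin (n i) → ℂ} (hg : 0 < g)
    (hga : g ^ 2 + ∑ s, ‖a s‖ ^ 2 = 1) (hx : ∀ i, vecNormSq (x i) = 1) :
    Fobj A B g a x ∈ perturbationCosts A B := by
  have hg' : (g : ℂ) ≠ 0 := by exact_mod_cast hg.ne'
  choose Ah Bh hzero hcost using fun i =>
    exists_perturbation (A i) (B i) (g : ℂ) a (x i) (by simpa using hga) (hx i)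
  refine ⟨Ah, Bh, fun s => (g : ℂ)⁻¹ * a s, x, hx, fun i => ?_, ?_⟩
  · simp_rw [mul_smul, ← Finset.smul_sum]
    rw [← sub_eq_zero.1 (hzero i), inv_smul_smul₀ hg']
  · exact Finset.sum_congr rfl fun i _ => (hcost i).symm

lemma sInf_perturbationCosts_le {γ : ℝ} {α : Fin k → ℂ} {x : ∀ i, Fin (n i) → ℂ} (h0 : 0 ≤ γ)
    (h1 : γ ^ 2 + ∑ s, ‖α s‖ ^ 2 = 1) (h2 : ∀ i, vecNormSq (x i) = 1) :
    sInf (perturbationCosts A B) ≤ Fobj A B γ α x := by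
  have hbdd := bddBelow_perturbationCosts A B
  rcases h0.lt_or_eq with hpos | rfl
  · exact csInf_le hbdd (Fobj_mem_perturbationCosts A B hpos h1 h2)
  · have hpath : Continuous fun t : ℝ =>
        ((Real.sin t, (Real.cos t : ℂ) • α, x) : ℝ × (Fin k → ℂ) × (∀ i, Fin (n i) → ℂ)) := by
      fun_prop
    have hcont : Continuous fun t : ℝ =>
        Fobj A B (Real.sin t) ((Real.cos t : ℂ) • α) x := by
      have h := (continuous_Fobj A B).comp hpath
      simpa only [Function.comp_def] using h
    have hlim := (hcont.tendsto 0).mono_left (nhdsWithin_le_nhds (s := Set.Ioi 0))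
    simp only [Real.sin_zero, Real.cos_zero, Complex.ofReal_one, one_smul] at hlim
    refine ge_of_tendsto hlim ?_
    filter_upwards [Ioo_mem_nhdsGT Real.pi_pos] with t ht
    refine csInf_le hbdd (Fobj_mem_perturbationCosts A B
      (Real.sin_pos_of_pos_of_lt_pi ht.1 ht.2) ?_ h2)
    have hsmul := vecNormSq_smul (Real.cos t : ℂ) α
    have hα : vecNormSq α = 1 := by simpa [vecNormSq] using h1
    rw [hα, mul_one, Complex.norm_real, Real.norm_eq_abs, sq_abs] at hsmul
    change _ + vecNormSq _ = 1
    rw [hsmul, Real.sin_sq_add_cos_sq]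

lemma exists_Fobj_le_of_mem_perturbationCosts {t : ℝ} (ht : t ∈ perturbationCosts A B) :
    ∃ (c : ℝ) (a : Fin k → ℂ) (x : ∀ i, Fin (n i) → ℂ), 0 ≤ c ∧
      c ^ 2 + ∑ s, ‖a s‖ ^ 2 = 1 ∧ (∀ i, vecNormSq (x i) = 1) ∧ Fobj A B c a x ≤ t := by
  obtain ⟨Ah, Bh, lam, xx, hxx, heq, rfl⟩ := ht
  obtain ⟨c, hc0, hc2⟩ : ∃ c : ℝ, 0 ≤ c ∧ c ^ 2 * (1 + ∑ s, ‖lam s‖ ^ 2) = 1 := by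
    refine ⟨(√(1 + ∑ s, ‖lam s‖ ^ 2))⁻¹, by positivity, ?_⟩
    rw [inv_pow, Real.sq_sqrt (by positivity)]
    exact inv_mul_cancel₀ (by positivity)
  have hnorm : c ^ 2 + ∑ s, ‖((c : ℂ) • lam) s‖ ^ 2 = 1 := by
    rw [← hc2, mul_add, mul_one, Finset.mul_sum]
    simp [mul_pow]
  refine ⟨c, (c : ℂ) • lam, xx, hc0, hnorm, hxx, Finset.sum_le_sum fun i _ => ?_⟩
  refine vecNormSq_residual_le (A i) (Ah i) (B i) (Bh i) c _ (xx i) ?_ (hxx i) ?_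
  · simpa using hnorm
  · simp [heq i, Finset.smul_sum, mul_smul]

end

/-- Theorem 4.2: the homogeneous objective attains its minimum on the compact
constraint set, and the minimum value equals `θ₁`. -/
theorem stmt1 (k : ℕ) (hk : 1 ≤ k) (m n : Fin k → ℕ) (hn : ∀ i, 0 < n i)
    (A : ∀ i, Matrix (Fin (m i)) (Fin (n i)) ℂ)
    (B : ∀ i, Fin k → Matrix (Fin (m i)) (Fin (n i)) ℂ) :
    ∃ (γ : ℝ) (α : Fin k → ℂ) (x : ∀ i, Fin (n i) → ℂ),
      (0 ≤ γ ∧ γ ^ 2 + ∑ s, ‖α s‖ ^ 2 = 1 ∧ (∀ i, vecNormSq (x i) = 1)) ∧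
      (∀ (γ' : ℝ) (α' : Fin k → ℂ) (x' : ∀ i, Fin (n i) → ℂ),
        0 ≤ γ' → γ' ^ 2 + ∑ s, ‖α' s‖ ^ 2 = 1 → (∀ i, vecNormSq (x' i) = 1) →
        Fobj A B γ α x ≤ Fobj A B γ' α' x') ∧
      Fobj A B γ α x =
        sInf {t : ℝ |
          ∃ (Ah : ∀ i, Matrix (Fin (m i)) (Fin (n i)) ℂ)
            (Bh : ∀ i, Fin k → Matrix (Fin (m i)) (Fin (n i)) ℂ)
            (lam : Fin k → ℂ) (xx : ∀ i, Fin (n i) → ℂ),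
            (∀ i, vecNormSq (xx i) = 1) ∧
            (∀ i, (Ah i).mulVec (xx i) = ∑ s, lam s • (Bh i s).mulVec (xx i)) ∧
            t = ∑ i, frobSq (hcat (Ah i - A i) (fun s => Bh i s - B i s))} := by
  obtain ⟨⟨γ, α, x⟩, ⟨h0, h1, h2⟩, hmin⟩ := (isCompact_constraintSet n).exists_isMinOn
    (constraintSet_nonempty n hn) (continuous_Fobj A B).continuousOn
  dsimp only at h0 h1 h2
  have hmin' : ∀ (γ' : ℝ) (α' : Fin k → ℂ) (x' : ∀ i, Fin (n i) → ℂ),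
      0 ≤ γ' → γ' ^ 2 + ∑ s, ‖α' s‖ ^ 2 = 1 → (∀ i, vecNormSq (x' i) = 1) →
      Fobj A B γ α x ≤ Fobj A B γ' α' x' :=
    fun γ' α' x' a b c => isMinOn_iff.1 hmin (γ', α', x') ⟨a, b, c⟩
  refine ⟨γ, α, x, ⟨h0, h1, h2⟩, hmin', ?_⟩
  change _ = sInf (perturbationCosts A B)
  refine le_antisymm (le_csInf ?_ fun t ht => ?_) (sInf_perturbationCosts_le A B h0 h1 h2)
  · exact ⟨_, Fobj_mem_perturbationCosts A B (a := 0) one_pos (by simp) h2⟩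
  · obtain ⟨c, a, y, hc, hca, hy, hle⟩ := exists_Fobj_le_of_mem_perturbationCosts A B ht
    exact (hmin' c a y hc hca hy).trans hle

end
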